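/- Let N ≥ 1, let z ≠ 0 and b_1,…,b_N be real parameters. On the open subset of ℝ^{2N} where every q_i ≠ 0, define K_i^{(N)} = −Σ_{k=1}^{i−1} q_k² + Σ_{l=i+1}^{N} q_l² and the deformed realization J_-^{(N)} = Σ_{i=1}^N q_i², J_+^{(N)} = Σ_{i=1}^N ( (sinh(z q_i²)/(z q_i²)) p_i² + z b_i / sinh(z q_i²) ) e^{z K_i^{(N)}}, J_3^{(N)} = Σ_{i=1}^N (sinh(z q_i²)/(z q_i²)) q_i p_i e^{z K_i^{(N)}}. Then with respect to the canonical Poisson bracket these functions close the non-standard deformed brackets: {J_3^{(N)}, J_+^{(N)}} = 2 J_+^{(N)} cosh(z J_-^{(N)}), {J_3^{(N)}, J_-^{(N)}} = −2 sinh(z J_-^{(N)})/z, {J_-^{(N)}, J_+^{(N)}} = 4 J_3^{(N)}. -/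

import Mathlib

open scoped BigOperators
open Real

noncomputable section

/-- Phase space ℝ^{2N} with canonical coordinates (q, p). -/
abbrev Phase (N : ℕ) : Type := (Fin N → ℝ) × (Fin N → ℝ)

/-- The canonical Poisson bracket
`{f,g} = ∑ i, (∂f/∂q_i · ∂g/∂p_i − ∂g/∂q_i · ∂f/∂p_i)`. -/
noncomputable def pb {N : ℕ} (f g : Phase N → ℝ) (x : Phase N) : ℝ :=
  ∑ i : Fin N,
    ((fderiv ℝ f x) (Pi.single i 1, 0) * (fderiv ℝ g x) (0, Pi.single i 1)
      - (fderiv ℝ g x) (Pi.single i 1, 0) * (fderiv ℝ f x) (0, Pi.single i 1))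

/-- `K_i^{(h)} = −Σ_{k=1}^{i−1} q_k² + Σ_{l=i+1}^{h} q_l²` (paper's 1-indexed
ranges; here indices are 0-indexed, so the second sum runs over `i < l < h`). -/
noncomputable def Kf (N : ℕ) (h : ℕ) (i : Fin N) (q : Fin N → ℝ) : ℝ :=
  ∑ k : Fin N, if (k : ℕ) < (i : ℕ) then -(q k) ^ 2
    else if (i : ℕ) < (k : ℕ) ∧ (k : ℕ) < h then (q k) ^ 2 else 0

/-- `K̃_i^{(h)} = −Σ_{k=h}^{i−1} q_k² + Σ_{l=i+1}^{N} q_l²` (paper's 1-indexed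
lower bound `h`; here `t = h − 1` is the 0-indexed lower bound). -/
noncomputable def Kt (N : ℕ) (t : ℕ) (i : Fin N) (q : Fin N → ℝ) : ℝ :=
  ∑ k : Fin N, if t ≤ (k : ℕ) ∧ (k : ℕ) < (i : ℕ) then -(q k) ^ 2
    else if (i : ℕ) < (k : ℕ) then (q k) ^ 2 else 0

/-- The deformed `J_-^{(N)} = Σ q_i²`. -/
noncomputable def Jmz (N : ℕ) : Phase N → ℝ := fun x => ∑ i : Fin N, (x.1 i) ^ 2

/-- The deformed
`J_+^{(N)} = Σ_i ((sinh(z q_i²)/(z q_i²)) p_i² + z b_i/sinh(z q_i²)) e^{z K_i^{(N)}}`. -/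
noncomputable def Jpz (N : ℕ) (z : ℝ) (b : Fin N → ℝ) : Phase N → ℝ :=
  fun x => ∑ i : Fin N,
    (Real.sinh (z * (x.1 i) ^ 2) / (z * (x.1 i) ^ 2) * (x.2 i) ^ 2
        + z * b i / Real.sinh (z * (x.1 i) ^ 2))
      * Real.exp (z * Kf N N i x.1)

/-- The deformed `J_3^{(N)} = Σ_i (sinh(z q_i²)/(z q_i²)) q_i p_i e^{z K_i^{(N)}}`. -/
noncomputable def J3z (N : ℕ) (z : ℝ) : Phase N → ℝ :=
  fun x => ∑ i : Fin N,
    Real.sinh (z * (x.1 i) ^ 2) / (z * (x.1 i) ^ 2) * (x.1 i * x.2 i)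
      * Real.exp (z * Kf N N i x.1)

/-- The coefficient of `q_k²` in `K_i^{(N)}`: the sign of `k - i`. -/
def kSign {N : ℕ} (i k : Fin N) : ℝ :=
  if (k : ℕ) < i then -1 else if (i : ℕ) < k then 1 else 0

theorem kSign_antisymm {N : ℕ} (i k : Fin N) : kSign i k = -kSign k i := by
  unfold kSign
  split_ifs <;> first | omega | norm_num

theorem Kf_eq_sum_kSign {N : ℕ} (i : Fin N) (q : Fin N → ℝ) :
    Kf N N i q = ∑ k, kSign i k * q k ^ 2 := by
  unfold Kf kSign
  refine Finset.sum_congr rfl fun k _ => ?_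
  have := k.isLt
  split_ifs <;> first | omega | ring

/-- The differential of the coordinate `q_i`. -/
def dq {N : ℕ} (i : Fin N) : Phase N →L[ℝ] ℝ :=
  (ContinuousLinearMap.proj i).comp (ContinuousLinearMap.fst ℝ (Fin N → ℝ) (Fin N → ℝ))

/-- The differential of the coordinate `p_i`. -/
def dp {N : ℕ} (i : Fin N) : Phase N →L[ℝ] ℝ :=
  (ContinuousLinearMap.proj i).comp (ContinuousLinearMap.snd ℝ (Fin N → ℝ) (Fin N → ℝ))

@[simp] theorem dq_apply {N : ℕ} (i : Fin N) (v : Phase N) : dq i v = v.1 i := rfl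

@[simp] theorem dp_apply {N : ℕ} (i : Fin N) (v : Phase N) : dp i v = v.2 i := rfl

theorem hasFDerivAt_q {N : ℕ} (i : Fin N) (x : Phase N) :
    HasFDerivAt (fun y : Phase N => y.1 i) (dq i) x := (dq i).hasFDerivAt

theorem hasFDerivAt_p {N : ℕ} (i : Fin N) (x : Phase N) :
    HasFDerivAt (fun y : Phase N => y.2 i) (dp i) x := (dp i).hasFDerivAt

theorem hasFDerivAt_Kf {N : ℕ} (i : Fin N) (x : Phase N) :
    HasFDerivAt (fun y : Phase N => Kf N N i y.1)
      (∑ k, (kSign i k * (2 * x.1 k)) • dq k) x := by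
  simp only [Kf_eq_sum_kSign]
  refine HasFDerivAt.fun_sum fun k _ => ?_
  refine (((hasFDerivAt_q k x).pow 2).const_mul (kSign i k)).congr_fderiv ?_
  ext v <;> simp
  ring

/-- Differential of a sum of one-body functions weighted by `e^{z K_i}`. -/
theorem hasFDerivAt_sum_mul_exp_Kf {N : ℕ} (z : ℝ) (x : Phase N) (w : Fin N → Phase N → ℝ)
    (α β : Fin N → ℝ) (hw : ∀ i, HasFDerivAt (w i) (α i • dq i + β i • dp i) x) :
    HasFDerivAt (fun y => ∑ i, w i y * exp (z * Kf N N i y.1))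
      (∑ i, (w i x • (exp (z * Kf N N i x.1) • z • ∑ k, (kSign i k * (2 * x.1 k)) • dq k)
        + exp (z * Kf N N i x.1) • (α i • dq i + β i • dp i))) x :=
  HasFDerivAt.fun_sum fun i _ => (hw i).mul ((hasFDerivAt_Kf i x).const_mul z).exp

theorem fderiv_sum_mul_exp_Kf_q {N : ℕ} (z : ℝ) (x : Phase N) (w : Fin N → Phase N → ℝ)
    (α β : Fin N → ℝ) (hw : ∀ i, HasFDerivAt (w i) (α i • dq i + β i • dp i) x) (m : Fin N) :
    fderiv ℝ (fun y => ∑ i, w i y * exp (z * Kf N N i y.1)) x (Pi.single m 1, 0) =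
      α m * exp (z * Kf N N m x.1)
        + 2 * z * x.1 m * ∑ i, kSign i m * (w i x * exp (z * Kf N N i x.1)) := by
  rw [(hasFDerivAt_sum_mul_exp_Kf z x w α β hw).fderiv]
  simp only [sum_apply, add_apply,
    smul_apply, dq_apply, dp_apply, smul_eq_mul, Pi.zero_apply, mul_zero,
    add_zero, Pi.single_apply, mul_ite, mul_one, Finset.sum_ite_eq', Finset.mem_univ, if_true,
    Finset.sum_add_distrib, Finset.mul_sum]
  rw [add_comm]
  congr 1
  · ring
  · exact Finset.sum_congr rfl fun i _ => by ring

theorem fderiv_sum_mul_exp_Kf_p {N : ℕ} (z : ℝ) (x : Phase N) (w : Fin N → Phase N → ℝ)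
    (α β : Fin N → ℝ) (hw : ∀ i, HasFDerivAt (w i) (α i • dq i + β i • dp i) x) (m : Fin N) :
    fderiv ℝ (fun y => ∑ i, w i y * exp (z * Kf N N i y.1)) x (0, Pi.single m 1) =
      β m * exp (z * Kf N N m x.1) := by
  rw [(hasFDerivAt_sum_mul_exp_Kf z x w α β hw).fderiv]
  simp [Pi.single_apply, mul_comm]

theorem hasFDerivAt_Jmz {N : ℕ} (x : Phase N) :
    HasFDerivAt (Jmz N) (∑ i, (2 * x.1 i) • dq i) x := by
  refine HasFDerivAt.fun_sum fun k _ => ?_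
  refine ((hasFDerivAt_q k x).pow 2).congr_fderiv ?_
  ext v <;> simp

theorem fderiv_Jmz_q {N : ℕ} (x : Phase N) (m : Fin N) :
    fderiv ℝ (Jmz N) x (Pi.single m 1, 0) = 2 * x.1 m := by
  rw [(hasFDerivAt_Jmz x).fderiv]
  simp [Pi.single_apply]

theorem fderiv_Jmz_p {N : ℕ} (x : Phase N) (m : Fin N) :
    fderiv ℝ (Jmz N) x (0, Pi.single m 1) = 0 := by
  rw [(hasFDerivAt_Jmz x).fderiv]
  simp

theorem hasDerivAt_sinh_mul_sq (z q : ℝ) :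
    HasDerivAt (fun t => sinh (z * t ^ 2)) (cosh (z * q ^ 2) * (2 * z * q)) q := by
  refine ((hasDerivAt_pow 2 q).const_mul z).sinh.congr_deriv ?_
  push_cast
  ring

theorem hasDerivAt_sinh_div_sq {z q : ℝ} (hz : z ≠ 0) (hq : q ≠ 0) :
    HasDerivAt (fun t => sinh (z * t ^ 2) / (z * t ^ 2))
      ((2 * cosh (z * q ^ 2) - 2 * (sinh (z * q ^ 2) / (z * q ^ 2))) / q) q := by
  refine ((hasDerivAt_sinh_mul_sq z q).fun_div ((hasDerivAt_pow 2 q).const_mul z)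
    (mul_ne_zero hz (pow_ne_zero 2 hq))).congr_deriv ?_
  push_cast
  field_simp

theorem sinh_mul_sq_ne_zero {z q : ℝ} (hz : z ≠ 0) (hq : q ≠ 0) : sinh (z * q ^ 2) ≠ 0 :=
  sinh_eq_zero.not.mpr (mul_ne_zero hz (pow_ne_zero 2 hq))

theorem hasFDerivAt_J3z_term {N : ℕ} {z : ℝ} (hz : z ≠ 0) {x : Phase N} {i : Fin N}
    (hq : x.1 i ≠ 0) :
    HasFDerivAt (fun y : Phase N =>
        sinh (z * y.1 i ^ 2) / (z * y.1 i ^ 2) * (y.1 i * y.2 i))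
      (((2 * cosh (z * x.1 i ^ 2) - sinh (z * x.1 i ^ 2) / (z * x.1 i ^ 2)) * x.2 i) • dq i
        + (sinh (z * x.1 i ^ 2) / (z * x.1 i ^ 2) * x.1 i) • dp i) x := by
  refine (((hasDerivAt_sinh_div_sq hz hq).comp_hasFDerivAt x (hasFDerivAt_q i x)).mul
    ((hasFDerivAt_q i x).mul (hasFDerivAt_p i x))).congr_fderiv ?_
  ext v <;> simp <;> field_simp
  ring

theorem hasFDerivAt_Jpz_term {N : ℕ} {z : ℝ} (hz : z ≠ 0) (c : ℝ) {x : Phase N} {i : Fin N}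
    (hq : x.1 i ≠ 0) :
    HasFDerivAt (fun y : Phase N =>
        sinh (z * y.1 i ^ 2) / (z * y.1 i ^ 2) * y.2 i ^ 2 + z * c / sinh (z * y.1 i ^ 2))
      (((2 * cosh (z * x.1 i ^ 2) - 2 * (sinh (z * x.1 i ^ 2) / (z * x.1 i ^ 2))) / x.1 i
            * x.2 i ^ 2
          - 2 * z ^ 2 * c * x.1 i * cosh (z * x.1 i ^ 2) / sinh (z * x.1 i ^ 2) ^ 2) • dq i
        + (2 * (sinh (z * x.1 i ^ 2) / (z * x.1 i ^ 2)) * x.2 i) • dp i) x := by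
  have hs := sinh_mul_sq_ne_zero hz hq
  refine ((((hasDerivAt_sinh_div_sq hz hq).comp_hasFDerivAt x (hasFDerivAt_q i x)).mul
    ((hasFDerivAt_p i x).pow 2)).add
      (((hasDerivAt_const (x.1 i) (z * c)).div (hasDerivAt_sinh_mul_sq z (x.1 i))
        hs).comp_hasFDerivAt x (hasFDerivAt_q i x))).congr_fderiv ?_
  ext v <;> simp <;> field_simp
  ring

/-- Half the exponential of `z` times (tail sum minus head sum) of the `q_k²`, split at `n`. -/
def halfExp {N : ℕ} (z : ℝ) (q : Fin N → ℝ) (n : ℕ) : ℝ :=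
  exp (z * ∑ k : Fin N, if (k : ℕ) < n then -(q k) ^ 2 else (q k) ^ 2) / 2

theorem halfExp_castSucc {N : ℕ} (z : ℝ) (q : Fin N → ℝ) (m : Fin N) :
    halfExp z q m = exp (z * q m ^ 2) * exp (z * Kf N N m q) / 2 := by
  have h : (∑ k : Fin N, if (k : ℕ) < m then -(q k) ^ 2 else (q k) ^ 2)
      = q m ^ 2 + Kf N N m q := by
    have hm : q m ^ 2 = ∑ k, if k = m then q k ^ 2 else 0 := by simp
    rw [Kf_eq_sum_kSign, hm, ← Finset.sum_add_distrib]
    refine Finset.sum_congr rfl fun k _ => ?_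
    simp only [kSign, Fin.ext_iff]
    split_ifs <;> first | omega | ring
  rw [halfExp, h, mul_add, exp_add]

theorem halfExp_succ {N : ℕ} (z : ℝ) (q : Fin N → ℝ) (m : Fin N) :
    halfExp z q (m + 1) = exp (-(z * q m ^ 2)) * exp (z * Kf N N m q) / 2 := by
  have h : (∑ k : Fin N, if (k : ℕ) < m + 1 then -(q k) ^ 2 else (q k) ^ 2)
      = -q m ^ 2 + Kf N N m q := by
    have hm : -q m ^ 2 = ∑ k, if k = m then -q k ^ 2 else 0 := by simp
    rw [Kf_eq_sum_kSign, hm, ← Finset.sum_add_distrib]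
    refine Finset.sum_congr rfl fun k _ => ?_
    simp only [kSign, Fin.ext_iff]
    split_ifs <;> first | omega | ring
  rw [halfExp, h, mul_add, exp_add, mul_neg]

theorem halfExp_zero {N : ℕ} (z : ℝ) (x : Phase N) :
    halfExp z x.1 0 = exp (z * Jmz N x) / 2 := by
  simp [halfExp, Jmz]

theorem halfExp_self {N : ℕ} (z : ℝ) (x : Phase N) :
    halfExp z x.1 N = exp (-(z * Jmz N x)) / 2 := by
  simp [halfExp, Jmz]

theorem sinh_mul_exp_Kf {N : ℕ} (z : ℝ) (q : Fin N → ℝ) (m : Fin N) :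
    sinh (z * q m ^ 2) * exp (z * Kf N N m q) = halfExp z q m - halfExp z q (m + 1) := by
  rw [halfExp_castSucc, halfExp_succ, sinh_eq]
  ring

theorem cosh_mul_exp_Kf {N : ℕ} (z : ℝ) (q : Fin N → ℝ) (m : Fin N) :
    cosh (z * q m ^ 2) * exp (z * Kf N N m q) = halfExp z q m + halfExp z q (m + 1) := by
  rw [halfExp_castSucc, halfExp_succ, cosh_eq]
  ring

theorem sum_sinh_mul_exp_Kf {N : ℕ} (z : ℝ) (x : Phase N) :
    ∑ m, sinh (z * x.1 m ^ 2) * exp (z * Kf N N m x.1) = sinh (z * Jmz N x) := by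
  simp only [sinh_mul_exp_Kf]
  rw [Fin.sum_univ_eq_sum_range (fun n => halfExp z x.1 n - halfExp z x.1 (n + 1)),
    Finset.sum_range_sub', halfExp_zero, halfExp_self, sinh_eq]
  ring

theorem sum_range_sign_mul_sub (c : ℕ → ℝ) {i n : ℕ} (hi : i < n) :
    ∑ k ∈ Finset.range n, (if k < i then -1 else if i < k then 1 else 0) * (c k - c (k + 1)) =
      c i + c (i + 1) - c 0 - c n := by
  induction n, hi using Nat.le_induction with
  | base =>
    rw [Finset.sum_range_succ, Finset.sum_congr rfl fun k hk => by
      rw [if_pos (Finset.mem_range.mp hk), neg_one_mul], Finset.sum_neg_distrib,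
      Finset.sum_range_sub']
    simp
    ring
  | succ n hn ih =>
    have hn' : i < n := hn
    rw [Finset.sum_range_succ, ih, if_neg hn'.not_gt, if_pos hn']
    ring

theorem cosh_sub_sum_kSign {N : ℕ} (z : ℝ) (x : Phase N) (i : Fin N) :
    cosh (z * x.1 i ^ 2) * exp (z * Kf N N i x.1)
      - ∑ m, kSign i m * (sinh (z * x.1 m ^ 2) * exp (z * Kf N N m x.1)) =
      cosh (z * Jmz N x) := by
  simp only [sinh_mul_exp_Kf, cosh_mul_exp_Kf, kSign]
  rw [Fin.sum_univ_eq_sum_range (fun n => (if n < (i : ℕ) then -1 else if (i : ℕ) < n then 1 else 0)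
      * (halfExp z x.1 n - halfExp z x.1 (n + 1))),
    sum_range_sign_mul_sub _ i.isLt, halfExp_zero, halfExp_self, cosh_eq]
  ring

theorem sum_sum_kSign_mul_symm {N : ℕ} (u : Fin N → ℝ) :
    ∑ m, u m * ∑ i, kSign i m * u i = 0 := by
  simp only [Finset.mul_sum]
  have h : ∑ m, ∑ i, u m * (kSign i m * u i) = -∑ m, ∑ i, u m * (kSign i m * u i) := by
    conv_lhs => rw [Finset.sum_comm]
    simp only [← Finset.sum_neg_distrib]
    refine Finset.sum_congr rfl fun m _ => Finset.sum_congr rfl fun i _ => ?_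
    rw [kSign_antisymm m i]
    ring
  linarith

theorem pb_J3z_Jmz {N : ℕ} {z : ℝ} (hz : z ≠ 0) {x : Phase N} (hx : ∀ i, x.1 i ≠ 0) :
    pb (J3z N z) (Jmz N) x = -2 * sinh (z * Jmz N x) / z := by
  have hp := fderiv_sum_mul_exp_Kf_p z x _ _ _ fun i => hasFDerivAt_J3z_term hz (hx i)
  rw [← sum_sinh_mul_exp_Kf, Finset.mul_sum, Finset.sum_div]
  refine Finset.sum_congr rfl fun m _ => ?_
  rw [fderiv_Jmz_p, fderiv_Jmz_q]
  unfold J3z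
  rw [hp]
  have := hx m
  field_simp
  ring

theorem pb_Jmz_Jpz {N : ℕ} {z : ℝ} (hz : z ≠ 0) (b : Fin N → ℝ) {x : Phase N}
    (hx : ∀ i, x.1 i ≠ 0) : pb (Jmz N) (Jpz N z b) x = 4 * J3z N z x := by
  have hp := fderiv_sum_mul_exp_Kf_p z x _ _ _ fun i => hasFDerivAt_Jpz_term hz (b i) (hx i)
  rw [J3z, Finset.mul_sum]
  refine Finset.sum_congr rfl fun m _ => ?_
  rw [fderiv_Jmz_p, fderiv_Jmz_q]
  unfold Jpz
  rw [hp]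
  ring

theorem pb_J3z_Jpz {N : ℕ} {z : ℝ} (hz : z ≠ 0) (b : Fin N → ℝ) {x : Phase N}
    (hx : ∀ i, x.1 i ≠ 0) :
    pb (J3z N z) (Jpz N z b) x = 2 * Jpz N z b x * cosh (z * Jmz N x) := by
  have hp := fderiv_sum_mul_exp_Kf_p z x _ _ _ fun i => hasFDerivAt_J3z_term hz (hx i)
  have hq := fderiv_sum_mul_exp_Kf_q z x _ _ _ fun i => hasFDerivAt_J3z_term hz (hx i)
  have hp' := fderiv_sum_mul_exp_Kf_p z x _ _ _ fun i => hasFDerivAt_Jpz_term hz (b i) (hx i)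
  have hq' := fderiv_sum_mul_exp_Kf_q z x _ _ _ fun i => hasFDerivAt_Jpz_term hz (b i) (hx i)
  set E : Fin N → ℝ := fun i => exp (z * Kf N N i x.1) with hE
  set u : Fin N → ℝ := fun i =>
    sinh (z * x.1 i ^ 2) / (z * x.1 i ^ 2) * (x.1 i * x.2 i) * E i with hu
  set w : Fin N → ℝ := fun i => (sinh (z * x.1 i ^ 2) / (z * x.1 i ^ 2) * x.2 i ^ 2
    + z * b i / sinh (z * x.1 i ^ 2)) * E i with hw
  set s : Fin N → ℝ := fun i => sinh (z * x.1 i ^ 2) * E i with hs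
  have hterm (m : Fin N) :
      fderiv ℝ (J3z N z) x (Pi.single m 1, 0) * fderiv ℝ (Jpz N z b) x (0, Pi.single m 1)
        - fderiv ℝ (Jpz N z b) x (Pi.single m 1, 0) * fderiv ℝ (J3z N z) x (0, Pi.single m 1) =
      2 * w m * (cosh (z * x.1 m ^ 2) * E m) + 4 * z * (u m * ∑ i, kSign i m * u i)
        - 2 * ∑ i, w i * (kSign i m * s m) := by
    have hsum : ∑ i, w i * (kSign i m * s m) = s m * ∑ i, kSign i m * w i := by
      rw [Finset.mul_sum]
      exact Finset.sum_congr rfl fun i _ => by ring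
    unfold J3z Jpz
    rw [hp, hq, hp', hq', hsum]
    change (_ * E m + 2 * z * x.1 m * ∑ i, kSign i m * u i) * (_ * E m)
      - (_ * E m + 2 * z * x.1 m * ∑ i, kSign i m * w i) * (_ * E m) = _
    generalize ∑ i, kSign i m * u i = U
    generalize ∑ i, kSign i m * w i = W
    have := hx m
    have := sinh_mul_sq_ne_zero hz (hx m)
    simp only [hu, hw, hs]
    generalize E m = e
    field_simp
    ring
  unfold pb
  simp only [hterm, Finset.sum_sub_distrib, Finset.sum_add_distrib, ← Finset.mul_sum,
    sum_sum_kSign_mul_symm]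
  rw [Finset.sum_comm, mul_zero, add_zero, Finset.mul_sum, ← Finset.sum_sub_distrib, Jpz,
    Finset.mul_sum, Finset.sum_mul]
  refine Finset.sum_congr rfl fun i _ => ?_
  rw [← cosh_sub_sum_kSign z x i, ← Finset.mul_sum]
  simp only [hw, hs, hE]
  ring

/-- the deformed realization closes the non-standard
`sl_z(2,ℝ)` brackets `{J_3,J_+} = 2J_+ cosh(zJ_-)`,
`{J_3,J_-} = −2 sinh(zJ_-)/z`, `{J_-,J_+} = 4J_3` on the open set where every
`q_i ≠ 0`. -/
theorem slz2_poisson_realization (N : ℕ) (hN : 1 ≤ N) (z : ℝ) (hz : z ≠ 0)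
    (b : Fin N → ℝ) (x : Phase N) (hx : ∀ i, x.1 i ≠ 0) :
    pb (J3z N z) (Jpz N z b) x = 2 * Jpz N z b x * Real.cosh (z * Jmz N x) ∧
    pb (J3z N z) (Jmz N) x = -2 * Real.sinh (z * Jmz N x) / z ∧
    pb (Jmz N) (Jpz N z b) x = 4 * J3z N z x := by
  exact ⟨pb_J3z_Jpz hz b hx, pb_J3z_Jmz hz hx, pb_Jmz_Jpz hz b hx⟩
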